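/- There exists a universal constant K > 0 such that for every ρ ∈ (0, 1), ∑_{u=0}^{∞} ρ^{u}·(1 + log(1 + ρ^{−u})) ≤ K/(1 − ρ). -/

import Mathlib

/-- Uniform bound on the geometric series appearing in the complexity analysis:
there is a universal constant `K > 0` with
`∑_{u≥0} ρ^u (1 + log(1 + ρ^{-u})) ≤ K / (1 - ρ)` for every `ρ ∈ (0,1)`. -/
theorem stmt_4 :
    ∃ K > (0 : ℝ), ∀ ρ : ℝ, 0 < ρ → ρ < 1 →
      (∑' u : ℕ, ρ ^ u * (1 + Real.log (1 + ρ ^ (-(u : ℤ))))) ≤ K / (1 - ρ) := by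
  refine ⟨3, by norm_num, fun ρ h0 h1 => ?_⟩
  have hn : ‖ρ‖ < 1 := by rw [Real.norm_eq_abs, abs_of_pos h0]; exact h1
  have hs1 := (hasSum_geometric_of_lt_one h0.le h1).mul_left 2
  have hs2 := (hasSum_coe_mul_geometric_of_norm_lt_one hn).mul_left (ρ⁻¹ - 1)
  have hs := hs1.add hs2
  have h1' : 1 - ρ ≠ 0 := by linarith
  have hval : 2 * (1 - ρ)⁻¹ + (ρ⁻¹ - 1) * (ρ / (1 - ρ) ^ 2) = 3 / (1 - ρ) := by
    field_simp
    ring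
  rw [hval] at hs
  have hx : ∀ u : ℕ, 1 ≤ (ρ⁻¹) ^ u := fun u => one_le_pow₀ ((one_le_inv₀ h0).2 h1.le)
  have he : ∀ u : ℕ, ρ ^ (-(u : ℤ)) = (ρ⁻¹) ^ u := fun u => by
    rw [zpow_neg, zpow_natCast, inv_pow]
  have hle : ∀ u : ℕ, ρ ^ u * (1 + Real.log (1 + ρ ^ (-(u : ℤ))))
      ≤ 2 * ρ ^ u + (ρ⁻¹ - 1) * (u * ρ ^ u) := by
    intro u
    rw [he]
    have hxu := hx u
    have a1 : Real.log (1 + (ρ⁻¹) ^ u) ≤ Real.log (2 * (ρ⁻¹) ^ u) :=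
      Real.log_le_log (by linarith) (by linarith)
    rw [Real.log_mul (by norm_num) (by linarith), Real.log_pow] at a1
    have a2 : Real.log 2 ≤ 2 - 1 := Real.log_le_sub_one_of_pos (by norm_num)
    have a3 : Real.log ρ⁻¹ ≤ ρ⁻¹ - 1 := Real.log_le_sub_one_of_pos (inv_pos.2 h0)
    have a4 := mul_le_mul_of_nonneg_left a3 (Nat.cast_nonneg (α := ℝ) u)
    have a5 : 1 + Real.log (1 + (ρ⁻¹) ^ u) ≤ 2 + u * (ρ⁻¹ - 1) := by linarith
    calc _ ≤ ρ ^ u * (2 + u * (ρ⁻¹ - 1)) := mul_le_mul_of_nonneg_left a5 (by positivity)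
      _ = _ := by ring
  have hnn : ∀ u : ℕ, 0 ≤ ρ ^ u * (1 + Real.log (1 + ρ ^ (-(u : ℤ)))) := by
    intro u
    rw [he]
    have := Real.log_nonneg (x := 1 + (ρ⁻¹) ^ u) (by linarith [hx u])
    positivity
  have hsum := Summable.of_nonneg_of_le hnn hle hs.summable
  exact hasSum_le hle hsum.hasSum hs
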